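/- arXiv:1612.02696 — 11 statements merged into one kernel-verified Lean document; each statement's English description precedes it below -/
import Mathlib

section
/- Let X be a finite set and let f : P(X) → ℝ be a nonnegative, monotone, submodular set function on X. Then for all sets A, B, C ⊆ X, it holds that f(A ∩ C)·f(B ∪ C) + f(A ∪ C)·f(B ∩ C) ≤ f(C)·(f(A) + f(B)). -/
theorem submodular_product_ineq {X : Type*} [DecidableEq X] [Fintype X]
    (f : Finset X → ℝ)
    (hnonneg : ∀ A : Finset X, 0 ≤ f A)
    (hmono : ∀ A B : Finset X, A ⊆ B → f A ≤ f B)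
    (hsub : ∀ A B : Finset X, f (A ∪ B) + f (A ∩ B) ≤ f A + f B) :
    ∀ A B C : Finset X,
      f (A ∩ C) * f (B ∪ C) + f (A ∪ C) * f (B ∩ C) ≤ f C * (f A + f B) := by
  intro A B C
  have hAC := mul_le_mul_of_nonneg_left (hsub A C) (hnonneg (B ∩ C))
  have hBC := mul_le_mul_of_nonneg_left (hsub B C) (hnonneg (A ∩ C))
  have hA := mul_nonneg
    (sub_nonneg.2 (hmono (B ∩ C) C Finset.inter_subset_right))
    (sub_nonneg.2 (hmono (A ∩ C) A Finset.inter_subset_left))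
  have hB := mul_nonneg
    (sub_nonneg.2 (hmono (A ∩ C) C Finset.inter_subset_right))
    (sub_nonneg.2 (hmono (B ∩ C) B Finset.inter_subset_left))
  linarith
end

section
/- Let X be a finite set and let f : P(X) → ℝ be a nonnegative, monotone, modular set function on X. Define the distance J_{δ,f}(A,B) = 1 − f(A ∩ B)/f(A ∪ B) if f(A ∪ B) ≠ 0, and J_{δ,f}(A,B) = 0 if f(A ∪ B) = 0. Then for all sets A, B, C ⊆ X, the triangle inequality J_{δ,f}(A,B) ≤ J_{δ,f}(A,C) + J_{δ,f}(C,B) holds. -/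
/-- The Jaccard-type distance associated to a set function `f`. -/
noncomputable def Jdelta {X : Type*} [DecidableEq X] [Fintype X]
    (f : Finset X → ℝ) (A B : Finset X) : ℝ :=
  if f (A ∪ B) = 0 then 0 else 1 - f (A ∩ B) / f (A ∪ B)

theorem Jdelta_le_sub_div {X : Type*} [DecidableEq X] [Fintype X] {f : Finset X → ℝ}
    (hnonneg : ∀ A : Finset X, 0 ≤ f A) (hmono : ∀ A B : Finset X, A ⊆ B → f A ≤ f B)
    {A B U : Finset X} (hU : A ∪ B ⊆ U) (hpos : 0 < f U) :
    Jdelta f A B ≤ (f U - f (A ∩ B)) / f U := by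
  have hle := hmono _ _ hU
  have hinter : f (A ∩ B) ≤ f (A ∪ B) :=
    hmono _ _ (Finset.inter_subset_left.trans Finset.subset_union_left)
  unfold Jdelta
  split_ifs with h
  · exact div_nonneg (by linarith) hpos.le
  · have hAB : 0 < f (A ∪ B) := (hnonneg _).lt_of_ne' h
    rw [sub_div, div_self hpos.ne']
    have := div_le_div_of_nonneg_left (hnonneg (A ∩ B)) hAB hle
    linarith

theorem sub_div_le_Jdelta {X : Type*} [DecidableEq X] [Fintype X] {f : Finset X → ℝ}
    (hnonneg : ∀ A : Finset X, 0 ≤ f A) (hmono : ∀ A B : Finset X, A ⊆ B → f A ≤ f B)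
    {A B U : Finset X} (hU : A ∪ B ⊆ U) (hpos : 0 < f U) :
    (f (A ∪ B) - f (A ∩ B)) / f U ≤ Jdelta f A B := by
  have hle := hmono _ _ hU
  have hinter : f (A ∩ B) ≤ f (A ∪ B) :=
    hmono _ _ (Finset.inter_subset_left.trans Finset.subset_union_left)
  unfold Jdelta
  split_ifs with h
  · exact div_nonpos_of_nonpos_of_nonneg (by linarith [hnonneg (A ∩ B)]) hpos.le
  · have hAB : 0 < f (A ∪ B) := (hnonneg _).lt_of_ne' h
    rw [← div_self h, ← sub_div]
    exact div_le_div_of_nonneg_left (by linarith) hAB hle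

theorem modular_sub_inter_le {X : Type*} [DecidableEq X] {f : Finset X → ℝ}
    (hmono : ∀ A B : Finset X, A ⊆ B → f A ≤ f B)
    (hmod : ∀ A B : Finset X, f (A ∪ B) + f (A ∩ B) = f A + f B) (A B C : Finset X) :
    f (A ∪ B ∪ C) - f (A ∩ B) ≤
      (f (A ∪ C) - f (A ∩ C)) + (f (C ∪ B) - f (C ∩ B)) := by
  have hunion := hmod (A ∪ C) (C ∪ B)
  have hinter := hmod (A ∩ C) (C ∩ B)
  have hU : (A ∪ C) ∪ (C ∪ B) = A ∪ B ∪ C := by grind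
  rw [hU] at hunion
  have h₁ : f ((A ∩ C) ∪ (C ∩ B)) ≤ f ((A ∪ C) ∩ (C ∪ B)) := hmono _ _ (by grind)
  have h₂ : f ((A ∩ C) ∩ (C ∩ B)) ≤ f (A ∩ B) := hmono _ _ (by grind)
  linarith

theorem modular_jaccard_triangle {X : Type*} [DecidableEq X] [Fintype X]
    (f : Finset X → ℝ)
    (hnonneg : ∀ A : Finset X, 0 ≤ f A)
    (hmono : ∀ A B : Finset X, A ⊆ B → f A ≤ f B)
    (hmod : ∀ A B : Finset X, f (A ∪ B) + f (A ∩ B) = f A + f B) :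
    ∀ A B C : Finset X, Jdelta f A B ≤ Jdelta f A C + Jdelta f C B := by
  intro A B C
  have hAB : A ∪ B ⊆ A ∪ B ∪ C := by grind
  have hAC : A ∪ C ⊆ A ∪ B ∪ C := by grind
  have hCB : C ∪ B ⊆ A ∪ B ∪ C := by grind
  rcases (hnonneg (A ∪ B ∪ C)).eq_or_lt with hzero | hpos
  · have hvanish : ∀ {S T : Finset X}, S ∪ T ⊆ A ∪ B ∪ C → Jdelta f S T = 0 := fun h =>
      if_pos (le_antisymm ((hmono _ _ h).trans_eq hzero.symm) (hnonneg _))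
    simp [hvanish hAB, hvanish hAC, hvanish hCB]
  · calc Jdelta f A B ≤ (f (A ∪ B ∪ C) - f (A ∩ B)) / f (A ∪ B ∪ C) :=
          Jdelta_le_sub_div hnonneg hmono hAB hpos
      _ ≤ ((f (A ∪ C) - f (A ∩ C)) + (f (C ∪ B) - f (C ∩ B))) / f (A ∪ B ∪ C) :=
          div_le_div_of_nonneg_right (modular_sub_inter_le hmono hmod A B C) hpos.le
      _ = (f (A ∪ C) - f (A ∩ C)) / f (A ∪ B ∪ C) +
            (f (C ∪ B) - f (C ∩ B)) / f (A ∪ B ∪ C) := add_div _ _ _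
      _ ≤ Jdelta f A C + Jdelta f C B :=
          add_le_add (sub_div_le_Jdelta hnonneg hmono hAC hpos)
            (sub_div_le_Jdelta hnonneg hmono hCB hpos)
end

section
/- Let X be a finite set and let f : P(X) → ℝ be a nonnegative, monotone, modular set function on X. Then for all sets A, B, C ⊆ X with f(A) > 0, f(B) > 0, and f(C) > 0, it holds that f(A ∩ C)/f(A ∪ C) + f(B ∩ C)/f(B ∪ C) ≤ (f(A) + f(B))/f(A ∪ B). -/
/-- A fraction at most one grows when its numerator and denominator grow by the same amount;
here the denominator `v` is first shrunk to `w`, then enlarged to `u`. -/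
theorem div_le_add_sub_div {x u v w : ℝ} (hx : 0 ≤ x) (hxw : x ≤ w) (hw : 0 < w)
    (hwv : w ≤ v) (hwu : w ≤ u) : x / v ≤ (x + (u - w)) / u := by
  refine (div_le_div_of_nonneg_left hx hw hwv).trans ?_
  rw [div_le_div_iff₀ hw (hw.trans_le hwu)]
  nlinarith [mul_nonneg (sub_nonneg.2 hwu) (sub_nonneg.2 hxw)]

theorem modular_jaccard_key_ineq {X : Type*} [DecidableEq X] [Fintype X]
    (f : Finset X → ℝ)
    (hnonneg : ∀ A : Finset X, 0 ≤ f A)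
    (hmono : ∀ A B : Finset X, A ⊆ B → f A ≤ f B)
    (hmod : ∀ A B : Finset X, f (A ∪ B) + f (A ∩ B) = f A + f B) :
    ∀ A B C : Finset X, 0 < f A → 0 < f B → 0 < f C →
      f (A ∩ C) / f (A ∪ C) + f (B ∩ C) / f (B ∪ C) ≤ (f A + f B) / f (A ∪ B) := by
  intro A B C hA hB _
  -- The part of `C` outside `A ∪ B` only enlarges the denominators on the left.
  obtain ⟨D, hD⟩ : ∃ D, D = C ∩ (A ∪ B) := ⟨_, rfl⟩
  have key (S : Finset X) (hS : 0 < f S) (hSU : S ⊆ A ∪ B) :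
      f (S ∩ C) / f (S ∪ C) ≤ (f (S ∩ C) + (f (A ∪ B) - f (S ∪ D))) / f (A ∪ B) := by
    apply div_le_add_sub_div (hnonneg _)
    · exact hmono _ _ (by grind)
    · exact hS.trans_le (hmono _ _ (by grind))
    · exact hmono _ _ (by grind)
    · exact hmono _ _ (by grind)
  refine (add_le_add (key A hA (by grind)) (key B hB (by grind))).trans ?_
  rw [← add_div]
  refine div_le_div_of_nonneg_right ?_ (hnonneg _)
  have hAC : A ∩ D = A ∩ C := by clear key; grind
  have hBC : B ∩ D = B ∩ C := by clear key; grind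
  have hCD : A ∩ C ∪ B ∩ C = D := by clear key; grind
  have hAD := hmod A D
  have hBD := hmod B D
  have hAB := hmod A B
  have hCC := hmod (A ∩ C) (B ∩ C)
  rw [hAC] at hAD
  rw [hBC] at hBD
  rw [hCD] at hCC
  have hABC : f (A ∩ C ∩ (B ∩ C)) ≤ f (A ∩ B) :=
    hmono _ _ (Finset.inter_subset_inter Finset.inter_subset_left Finset.inter_subset_left)
  linarith
end

section
/- Let X be a finite set and let f : P(X) → ℝ be a nonnegative, monotone, submodular set function on X. Define J^Δ_{δ,f}(A,B) = (f(A △ B) − f(∅))/f(A ∪ B) if f(A ∪ B) ≠ 0, and J^Δ_{δ,f}(A,B) = 0 if f(A ∪ B) = 0, where A △ B denotes the symmetric difference. Then for all sets A, B, C ⊆ X, the triangle inequality J^Δ_{δ,f}(A,B) ≤ J^Δ_{δ,f}(A,C) + J^Δ_{δ,f}(C,B) holds. -/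
/-- The symmetric-difference Jaccard distance associated to a set function `f`. -/
noncomputable def JdeltaSymm {X : Type*} [DecidableEq X] [Fintype X]
    (f : Finset X → ℝ) (A B : Finset X) : ℝ :=
  if f (A ∪ B) = 0 then 0 else (f (symmDiff A B) - f ∅) / f (A ∪ B)

/-- Enlarging the denominator can only decrease the symmetric-difference Jaccard distance. -/
theorem div_le_JdeltaSymm {X : Type*} [DecidableEq X] [Fintype X] {f : Finset X → ℝ}
    (hnonneg : ∀ A : Finset X, 0 ≤ f A)
    (hmono : ∀ A B : Finset X, A ⊆ B → f A ≤ f B) {A B U : Finset X} (hU : A ∪ B ⊆ U) :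
    (f (symmDiff A B) - f ∅) / f U ≤ JdeltaSymm f A B := by
  have hsymm : f (symmDiff A B) ≤ f (A ∪ B) := hmono _ _ symmDiff_le_sup
  have hempty : f ∅ ≤ f (symmDiff A B) := hmono _ _ (Finset.empty_subset _)
  unfold JdeltaSymm
  split_ifs with h
  · exact div_nonpos_of_nonpos_of_nonneg (by linarith [hnonneg ∅]) (hnonneg U)
  · have hpos : 0 < f (A ∪ B) := lt_of_le_of_ne (hnonneg _) (Ne.symm h)
    exact div_le_div_of_nonneg_left (sub_nonneg.2 hempty) hpos (hmono _ _ hU)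

theorem symmDiff_add_union_le {X : Type*} [DecidableEq X] {f : Finset X → ℝ}
    (hmono : ∀ A B : Finset X, A ⊆ B → f A ≤ f B)
    (hsub : ∀ A B : Finset X, f (A ∪ B) + f (A ∩ B) ≤ f A + f B) (A B C : Finset X) :
    f (symmDiff A B) + f (A ∪ B ∪ C) + f ∅ ≤
      f (A ∪ B) + f (symmDiff A C) + f (symmDiff C B) := by
  have h₁ := hsub (A ∪ B) (symmDiff A B ∪ C \ (A ∪ B))
  have hunion : (A ∪ B) ∪ (symmDiff A B ∪ C \ (A ∪ B)) = A ∪ B ∪ C := by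
    ext x
    simp only [Finset.mem_union, Finset.mem_symmDiff, Finset.mem_sdiff]
    tauto
  have hinter : (A ∪ B) ∩ (symmDiff A B ∪ C \ (A ∪ B)) = symmDiff A B := by
    ext x
    simp only [Finset.mem_union, Finset.mem_inter, Finset.mem_symmDiff, Finset.mem_sdiff]
    tauto
  have hcover : symmDiff A B ∪ C \ (A ∪ B) ⊆ symmDiff A C ∪ symmDiff C B := by
    intro x
    simp only [Finset.mem_union, Finset.mem_symmDiff, Finset.mem_sdiff]
    tauto
  rw [hunion, hinter] at h₁
  have h₂ := hmono _ _ hcover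
  have h₃ := hsub (symmDiff A C) (symmDiff C B)
  have h₄ := hmono ∅ (symmDiff A C ∩ symmDiff C B) (Finset.empty_subset _)
  linarith

theorem submodular_symmdiff_jaccard_triangle {X : Type*} [DecidableEq X] [Fintype X]
    (f : Finset X → ℝ)
    (hnonneg : ∀ A : Finset X, 0 ≤ f A)
    (hmono : ∀ A B : Finset X, A ⊆ B → f A ≤ f B)
    (hsub : ∀ A B : Finset X, f (A ∪ B) + f (A ∩ B) ≤ f A + f B) :
    ∀ A B C : Finset X, JdeltaSymm f A B ≤ JdeltaSymm f A C + JdeltaSymm f C B := by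
  intro A B C
  have hAC := div_le_JdeltaSymm hnonneg hmono (A := A) (B := C) (U := A ∪ B ∪ C) (by grind)
  have hCB := div_le_JdeltaSymm hnonneg hmono (A := C) (B := B) (U := A ∪ B ∪ C) (by grind)
  refine le_trans ?_ (add_le_add hAC hCB)
  rw [← add_div]
  have hempty : ∀ S, 0 ≤ f S - f ∅ := fun S => sub_nonneg.2 (hmono _ _ (Finset.empty_subset S))
  unfold JdeltaSymm
  split_ifs with h
  · exact div_nonneg (add_nonneg (hempty _) (hempty _)) (hnonneg _)
  have hpos : 0 < f (A ∪ B) := lt_of_le_of_ne (hnonneg _) (Ne.symm h)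
  have hle : f (A ∪ B) ≤ f (A ∪ B ∪ C) := hmono _ _ Finset.subset_union_left
  have hsymm : f (symmDiff A B) ≤ f (A ∪ B) := hmono _ _ symmDiff_le_sup
  have hkey := symmDiff_add_union_le hmono hsub A B C
  rw [div_le_div_iff₀ hpos (hpos.trans_le hle)]
  have hratio : f (symmDiff A B) - f ∅ ≤ f (A ∪ B) := by linarith [hnonneg ∅]
  calc (f (symmDiff A B) - f ∅) * f (A ∪ B ∪ C)
      ≤ (f (symmDiff A B) - f ∅ + (f (A ∪ B ∪ C) - f (A ∪ B))) * f (A ∪ B) := by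
        nlinarith [mul_nonneg (sub_nonneg.2 hratio) (sub_nonneg.2 hle)]
    _ ≤ (f (symmDiff A C) - f ∅ + (f (symmDiff C B) - f ∅)) * f (A ∪ B) :=
        mul_le_mul_of_nonneg_right (by linarith) hpos.le
end

section
/- Let X be a finite set and let f : P(X) → ℝ be a nonnegative, monotone, submodular set function on X. Define J_{δ,f}(A,B) = 1 − f(A ∩ B)/f(A ∪ B) and J^Δ_{δ,f}(A,B) = (f(A △ B) − f(∅))/f(A ∪ B) when f(A ∪ B) ≠ 0, and both equal to 0 when f(A ∪ B) = 0. Then for all A, B ⊆ X, it holds that 0 ≤ J_{δ,f}(A,B) ≤ J^Δ_{δ,f}(A,B). -/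
theorem jaccard_le_symmdiff_jaccard {X : Type*} [DecidableEq X] [Fintype X]
    (f : Finset X → ℝ)
    (hnonneg : ∀ A : Finset X, 0 ≤ f A)
    (hmono : ∀ A B : Finset X, A ⊆ B → f A ≤ f B)
    (hsub : ∀ A B : Finset X, f (A ∪ B) + f (A ∩ B) ≤ f A + f B) :
    ∀ A B : Finset X, 0 ≤ Jdelta f A B ∧ Jdelta f A B ≤ JdeltaSymm f A B := by
  intro A B
  unfold Jdelta JdeltaSymm
  split_ifs with h
  · exact ⟨le_rfl, le_rfl⟩
  have hpos : 0 < f (A ∪ B) := (hnonneg _).lt_of_ne' h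
  have hinter : f (A ∩ B) ≤ f (A ∪ B) :=
    hmono _ _ (Finset.inter_subset_left.trans Finset.subset_union_left)
  have hunion : symmDiff A B ∪ A ∩ B = A ∪ B := symmDiff_sup_inf A B
  have hdisj : symmDiff A B ∩ (A ∩ B) = ∅ := (disjoint_symmDiff_inf A B).eq_bot
  have hsymm := hsub (symmDiff A B) (A ∩ B)
  rw [hunion, hdisj] at hsymm
  rw [one_sub_div h]
  exact ⟨div_nonneg (sub_nonneg.2 hinter) hpos.le,
    div_le_div_of_nonneg_right (by linarith) hpos.le⟩
end

section
/- For finite sets A, B, define the Jaccard distance J_δ(A,B) = |A △ B| / |A ∪ B| if A ∪ B is nonempty, and J_δ(A,B) = 0 if A = B = ∅, where A △ B is the symmetric difference. Then for all finite sets A, B, C, the triangle inequality J_δ(A,B) ≤ J_δ(A,C) + J_δ(C,B) holds. -/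
/-- The Jaccard distance on finite sets. -/
noncomputable def jaccardDist {α : Type*} [DecidableEq α] (A B : Finset α) : ℝ :=
  if A ∪ B = ∅ then 0 else ((symmDiff A B).card : ℝ) / ((A ∪ B).card : ℝ)

lemma jaccardDist_eq_div {α : Type*} [DecidableEq α] (A B : Finset α) :
    jaccardDist A B = ((symmDiff A B).card : ℝ) / ((A ∪ B).card : ℝ) := by
  unfold jaccardDist
  split_ifs with h <;> simp [h]

lemma card_symmDiff_div_le_jaccardDist {α : Type*} [DecidableEq α] {A B U : Finset α}
    (h : A ∪ B ⊆ U) : ((symmDiff A B).card : ℝ) / (U.card : ℝ) ≤ jaccardDist A B := by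
  rcases (A ∪ B).eq_empty_or_nonempty with h' | h'
  · obtain ⟨rfl, rfl⟩ := Finset.union_eq_empty.mp h'
    simp [jaccardDist]
  · rw [jaccardDist_eq_div]
    have : 0 < (A ∪ B).card := h'.card_pos
    gcongr

lemma card_symmDiff_add_card_sdiff_le {α : Type*} [DecidableEq α] (A B C : Finset α) :
    (symmDiff A B).card + (C \ (A ∪ B)).card ≤ (symmDiff A C).card + (symmDiff C B).card := by
  have hdisj : Disjoint (symmDiff A B) (C \ (A ∪ B)) := by
    rw [Finset.disjoint_left]
    intro x
    simp only [Finset.mem_symmDiff, Finset.mem_sdiff, Finset.mem_union]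
    tauto
  rw [← Finset.card_union_of_disjoint hdisj]
  refine (Finset.card_le_card fun x => ?_).trans (Finset.card_union_le _ _)
  simp only [Finset.mem_symmDiff, Finset.mem_sdiff, Finset.mem_union]
  tauto

lemma jaccardDist_le_add_card_sdiff_div {α : Type*} [DecidableEq α] (A B C : Finset α) :
    jaccardDist A B ≤
      ((symmDiff A B).card + (C \ (A ∪ B)).card : ℝ) / ((C ∪ (A ∪ B)).card : ℝ) := by
  rcases (A ∪ B).eq_empty_or_nonempty with h | h
  · rw [jaccardDist, if_pos h]
    positivity
  · have hpos : (0 : ℝ) < (A ∪ B).card := by exact_mod_cast h.card_pos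
    have hle : ((symmDiff A B).card : ℝ) ≤ (A ∪ B).card := by
      exact_mod_cast Finset.card_le_card (symmDiff_le_sup (a := A) (b := B))
    rw [jaccardDist_eq_div, ← Finset.card_sdiff_add_card C, Nat.cast_add,
      div_le_div_iff₀ hpos (by positivity)]
    nlinarith [mul_le_mul_of_nonneg_right hle (Nat.cast_nonneg (α := ℝ) (C \ (A ∪ B)).card)]

theorem jaccardDist_triangle {α : Type*} [DecidableEq α] (A B C : Finset α) :
    jaccardDist A B ≤ jaccardDist A C + jaccardDist C B := by
  have hAC : A ∪ C ⊆ C ∪ (A ∪ B) := by grind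
  have hCB : C ∪ B ⊆ C ∪ (A ∪ B) := by grind
  calc jaccardDist A B
      ≤ ((symmDiff A B).card + (C \ (A ∪ B)).card : ℝ) / ((C ∪ (A ∪ B)).card : ℝ) :=
        jaccardDist_le_add_card_sdiff_div A B C
    _ ≤ ((symmDiff A C).card + (symmDiff C B).card : ℝ) / ((C ∪ (A ∪ B)).card : ℝ) := by
        refine div_le_div_of_nonneg_right ?_ (Nat.cast_nonneg _)
        exact_mod_cast card_symmDiff_add_card_sdiff_le A B C
    _ ≤ jaccardDist A C + jaccardDist C B := by
        rw [add_div]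
        exact add_le_add (card_symmDiff_div_le_jaccardDist hAC)
          (card_symmDiff_div_le_jaccardDist hCB)
end

section
/- For nonnegative vectors x, y ∈ ℝⁿ (with x ≠ 0 or y ≠ 0), define the generalized Jaccard distance d(x,y) = 1 − (Σ_{i=1}^n min(x_i, y_i)) / (Σ_{i=1}^n max(x_i, y_i)), and set d(x,y) = 0 when Σ_{i=1}^n max(x_i,y_i) = 0. Then for all nonnegative vectors x, y, z ∈ ℝⁿ, the triangle inequality d(x,y) ≤ d(x,z) + d(z,y) holds. -/
/-- The generalized Jaccard distance on nonnegative vectors in `ℝⁿ`. -/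
noncomputable def genJaccardDist {n : ℕ} (x y : Fin n → ℝ) : ℝ :=
  if (∑ i, max (x i) (y i)) = 0 then 0
  else 1 - (∑ i, min (x i) (y i)) / (∑ i, max (x i) (y i))

theorem genJaccardDist_eq_sum_abs_div {n : ℕ} (x y : Fin n → ℝ) :
    genJaccardDist x y = (∑ i, |x i - y i|) / ∑ i, max (x i) (y i) := by
  unfold genJaccardDist
  split_ifs with h
  · simp [h]
  · rw [one_sub_div h, ← Finset.sum_sub_distrib]
    simp only [max_sub_min_eq_abs']

theorem sum_abs_sub_le_sum_max {n : ℕ} {x y : Fin n → ℝ}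
    (hx : ∀ i, 0 ≤ x i) (hy : ∀ i, 0 ≤ y i) :
    ∑ i, |x i - y i| ≤ ∑ i, max (x i) (y i) := by
  refine Finset.sum_le_sum fun i _ => ?_
  rw [← max_sub_min_eq_abs']
  linarith [le_min (hx i) (hy i)]

theorem sum_max_le_sum_max_add {n : ℕ} (x y z : Fin n → ℝ) :
    ∑ i, max (x i) (z i) ≤ ∑ i, max (x i) (y i) +
      (∑ i, |x i - z i| + ∑ i, |z i - y i| - ∑ i, |x i - y i|) / 2 := by
  rw [← Finset.sum_add_distrib, ← Finset.sum_sub_distrib, Finset.sum_div,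
    ← Finset.sum_add_distrib]
  refine Finset.sum_le_sum fun i _ => ?_
  linarith [max_sub_min_eq_abs' (x i) (z i), max_add_min (x i) (z i),
    max_sub_min_eq_abs' (x i) (y i), max_add_min (x i) (y i), le_abs_self (z i - y i)]

/-- Enlarging the denominator can only decrease a quotient of nonnegative numbers, provided the
numerator vanishes together with the original denominator. -/
theorem div_le_div_of_le_of_le {a b t : ℝ} (ha : 0 ≤ a) (hab : a ≤ b) (hbt : b ≤ t) :
    a / t ≤ a / b := by
  rcases ha.eq_or_lt with rfl | ha
  · simp
  · exact div_le_div_of_nonneg_left ha.le (ha.trans_le hab) hbt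

theorem genJaccardDist_triangle {n : ℕ} (x y z : Fin n → ℝ)
    (hx : ∀ i, 0 ≤ x i) (hy : ∀ i, 0 ≤ y i) (hz : ∀ i, 0 ≤ z i) :
    genJaccardDist x y ≤ genJaccardDist x z + genJaccardDist z y := by
  simp only [genJaccardDist_eq_sum_abs_div]
  have hxy := sum_abs_sub_le_sum_max hx hy
  have hxz := sum_abs_sub_le_sum_max hx hz
  have hzy := sum_abs_sub_le_sum_max hz hy
  have hMxz := sum_max_le_sum_max_add x y z
  have hMzy := sum_max_le_sum_max_add y x z
  simp only [max_comm (y _), abs_sub_comm (y _)] at hMzy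
  simp only [abs_sub_comm (z _) (x _)] at hMzy
  have htri : ∑ i, |x i - y i| ≤ ∑ i, |x i - z i| + ∑ i, |z i - y i| := by
    rw [← Finset.sum_add_distrib]
    exact Finset.sum_le_sum fun i _ => abs_sub_le _ _ _
  have hp : 0 ≤ ∑ i, |x i - y i| := Finset.sum_nonneg fun i _ => abs_nonneg _
  have hq : 0 ≤ ∑ i, |x i - z i| := Finset.sum_nonneg fun i _ => abs_nonneg _
  have hr : 0 ≤ ∑ i, |z i - y i| := Finset.sum_nonneg fun i _ => abs_nonneg _
  generalize ∑ i, |x i - y i| = p at *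
  generalize ∑ i, |x i - z i| = q at *
  generalize ∑ i, |z i - y i| = r at *
  generalize ∑ i, max (x i) (y i) = M at *
  rcases (hp.trans hxy).eq_or_lt with rfl | hM
  · rw [div_zero]
    exact add_nonneg (div_nonneg hq (hq.trans hxz)) (div_nonneg hr (hr.trans hzy))
  calc p / M ≤ (q + r) / (M + (q + r - p) / 2) := by
        rw [div_le_div_iff₀ hM (by linarith)]
        nlinarith [mul_nonneg (sub_nonneg.2 htri) (show 0 ≤ M - p / 2 by linarith)]
    _ = q / (M + (q + r - p) / 2) + r / (M + (q + r - p) / 2) := add_div _ _ _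
    _ ≤ _ := add_le_add (div_le_div_of_le_of_le hq hxz hMxz)
        (div_le_div_of_le_of_le hr hzy (by linarith))
end

section
/- Let μ be a finite measure on a measurable space. For measurable sets A, B, define the Steinhaus distance d(A,B) = μ(A △ B)/μ(A ∪ B) if μ(A ∪ B) > 0, and d(A,B) = 0 if μ(A ∪ B) = 0. Then for all measurable sets A, B, C, the triangle inequality d(A,B) ≤ d(A,C) + d(C,B) holds. -/
open MeasureTheory

/-- The Steinhaus distance associated to a measure `μ`. -/
noncomputable def steinhausDist {Ω : Type*} [MeasurableSpace Ω]
    (μ : Measure Ω) (A B : Set Ω) : ℝ :=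
  if μ (A ∪ B) = 0 then 0 else (μ (symmDiff A B)).toReal / (μ (A ∪ B)).toReal

theorem steinhausDist_eq_real_div {Ω : Type*} [MeasurableSpace Ω]
    (μ : Measure Ω) (A B : Set Ω) :
    steinhausDist μ A B = μ.real (symmDiff A B) / μ.real (A ∪ B) := by
  unfold steinhausDist
  split_ifs with h
  · simp [Measure.real, h]
  · rfl

theorem real_symmDiff_div_le_steinhausDist {Ω : Type*} [MeasurableSpace Ω]
    (μ : Measure Ω) [IsFiniteMeasure μ] {A B U : Set Ω} (hU : A ∪ B ⊆ U) :
    μ.real (symmDiff A B) / μ.real U ≤ steinhausDist μ A B := by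
  rw [steinhausDist_eq_real_div]
  have hsub : μ.real (symmDiff A B) ≤ μ.real (A ∪ B) := measureReal_mono symmDiff_le_sup
  rcases measureReal_nonneg.eq_or_lt' (a := μ.real (A ∪ B)) with h | h
  · have : μ.real (symmDiff A B) = 0 := le_antisymm (h ▸ hsub) measureReal_nonneg
    simp [this]
  · exact div_le_div_of_nonneg_left measureReal_nonneg h (measureReal_mono hU)

theorem steinhausDist_le_div_add {Ω : Type*} [MeasurableSpace Ω]
    (μ : Measure Ω) [IsFiniteMeasure μ] (A B : Set Ω) {x : ℝ} (hx : 0 ≤ x) :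
    steinhausDist μ A B ≤ (μ.real (symmDiff A B) + x) / (μ.real (A ∪ B) + x) := by
  rw [steinhausDist_eq_real_div]
  have hsub : μ.real (symmDiff A B) ≤ μ.real (A ∪ B) := measureReal_mono symmDiff_le_sup
  have hs : 0 ≤ μ.real (symmDiff A B) := measureReal_nonneg
  rcases measureReal_nonneg.eq_or_lt' (a := μ.real (A ∪ B)) with h | h
  · rw [h, div_zero]
    positivity
  · rw [div_le_div_iff₀ h (by positivity)]
    nlinarith

theorem steinhausDist_triangle {Ω : Type*} [MeasurableSpace Ω]
    (μ : Measure Ω) [IsFiniteMeasure μ] (A B C : Set Ω)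
    (hA : MeasurableSet A) (hB : MeasurableSet B) (hC : MeasurableSet C) :
    steinhausDist μ A B ≤ steinhausDist μ A C + steinhausDist μ C B := by
  have hdisj : μ.real (A ∪ B ∪ C) = μ.real (A ∪ B) + μ.real (C \ (A ∪ B)) := by
    rw [← measureReal_union Set.disjoint_sdiff_right (hC.diff (hA.union hB)),
      Set.union_sdiff_self]
  have hnum : μ.real (symmDiff A B) + μ.real (C \ (A ∪ B)) ≤
      μ.real (symmDiff A C) + μ.real (symmDiff C B) := by
    have hd : Disjoint (symmDiff A B) (C \ (A ∪ B)) :=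
      Set.disjoint_sdiff_right.mono_left symmDiff_le_sup
    rw [← measureReal_union hd (hC.diff (hA.union hB))]
    refine (measureReal_mono ?_).trans (measureReal_union_le _ _)
    intro x
    simp only [Set.mem_union, Set.mem_symmDiff, Set.mem_sdiff]
    tauto
  calc steinhausDist μ A B
      ≤ (μ.real (symmDiff A B) + μ.real (C \ (A ∪ B))) / μ.real (A ∪ B ∪ C) :=
        hdisj ▸ steinhausDist_le_div_add μ A B measureReal_nonneg
    _ ≤ (μ.real (symmDiff A C) + μ.real (symmDiff C B)) / μ.real (A ∪ B ∪ C) := by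
        gcongr
    _ = μ.real (symmDiff A C) / μ.real (A ∪ B ∪ C) +
          μ.real (symmDiff C B) / μ.real (A ∪ B ∪ C) := add_div _ _ _
    _ ≤ steinhausDist μ A C + steinhausDist μ C B :=
        add_le_add (real_symmDiff_div_le_steinhausDist μ (by grind))
          (real_symmDiff_div_le_steinhausDist μ (by grind))
end

section
/- Let L be a distributive lattice and let f : L → ℝ be a nonnegative, monotone, submodular function on L. Then for all a, b, c ∈ L, it holds that f(a ⊓ c)·f(b ⊔ c) + f(a ⊔ c)·f(b ⊓ c) ≤ f(c)·(f(a) + f(b)). -/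
theorem lattice_submodular_product_ineq {L : Type*} [DistribLattice L]
    (f : L → ℝ)
    (hnonneg : ∀ a : L, 0 ≤ f a)
    (hmono : ∀ a b : L, a ≤ b → f a ≤ f b)
    (hsub : ∀ a b : L, f (a ⊔ b) + f (a ⊓ b) ≤ f a + f b) :
    ∀ a b c : L, f (a ⊓ c) * f (b ⊔ c) + f (a ⊔ c) * f (b ⊓ c) ≤ f c * (f a + f b) := by
  intro a b c
  have hac : 0 ≤ f c - f (a ⊓ c) := sub_nonneg.2 (hmono _ _ inf_le_right)
  have hbc : 0 ≤ f c - f (b ⊓ c) := sub_nonneg.2 (hmono _ _ inf_le_right)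
  have ha : 0 ≤ f a - f (a ⊓ c) := sub_nonneg.2 (hmono _ _ inf_le_left)
  have hb : 0 ≤ f b - f (b ⊓ c) := sub_nonneg.2 (hmono _ _ inf_le_left)
  have hsa : 0 ≤ f a + f c - (f (a ⊔ c) + f (a ⊓ c)) := sub_nonneg.2 (hsub a c)
  have hsb : 0 ≤ f b + f c - (f (b ⊔ c) + f (b ⊓ c)) := sub_nonneg.2 (hsub b c)
  linarith [mul_nonneg (hnonneg (a ⊓ c)) hsb, mul_nonneg (hnonneg (b ⊓ c)) hsa,
    mul_nonneg hbc ha, mul_nonneg hac hb]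
end

section
/- Let L be a distributive lattice and let f : L → ℝ be a nonnegative, monotone, modular function on L. Define J_{δ,f}(a,b) = 1 − f(a ⊓ b)/f(a ⊔ b) if f(a ⊔ b) ≠ 0, and J_{δ,f}(a,b) = 0 if f(a ⊔ b) = 0. Then for all a, b, c ∈ L, the triangle inequality J_{δ,f}(a,b) ≤ J_{δ,f}(a,c) + J_{δ,f}(c,b) holds. -/
/-- The Jaccard-type distance associated to a function `f` on a lattice. -/
noncomputable def latticeJdelta {L : Type*} [DistribLattice L]
    (f : L → ℝ) (a b : L) : ℝ :=
  if f (a ⊔ b) = 0 then 0 else 1 - f (a ⊓ b) / f (a ⊔ b)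

/-- The distance `latticeJdelta f a b` is nonnegative. -/
lemma latticeJdelta_nonneg {L : Type*} [DistribLattice L] {f : L → ℝ}
    (hnonneg : ∀ a : L, 0 ≤ f a) (hmono : ∀ a b : L, a ≤ b → f a ≤ f b) (a b : L) :
    0 ≤ latticeJdelta f a b := by
  unfold latticeJdelta
  split_ifs
  · exact le_rfl
  · exact sub_nonneg.2 (div_le_one_of_le₀ (hmono _ _ inf_le_sup) (hnonneg _))

/-- The distance `latticeJdelta f a b` is at most one. -/
lemma latticeJdelta_le_one {L : Type*} [DistribLattice L] {f : L → ℝ}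
    (hnonneg : ∀ a : L, 0 ≤ f a) (a b : L) : latticeJdelta f a b ≤ 1 := by
  unfold latticeJdelta
  split_ifs
  · exact zero_le_one
  · exact sub_le_self _ (div_nonneg (hnonneg _) (hnonneg _))

/-- Clearing the denominator in `latticeJdelta`, including the degenerate case. -/
lemma latticeJdelta_mul_sup {L : Type*} [DistribLattice L] {f : L → ℝ}
    (hnonneg : ∀ a : L, 0 ≤ f a) (hmono : ∀ a b : L, a ≤ b → f a ≤ f b) (a b : L) :
    latticeJdelta f a b * f (a ⊔ b) = f (a ⊔ b) - f (a ⊓ b) := by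
  unfold latticeJdelta
  split_ifs with h
  · have h₁ := hmono (a ⊓ b) (a ⊔ b) inf_le_sup
    have h₂ := hnonneg (a ⊓ b)
    linarith
  · field_simp

/-- A strengthened triangle inequality for the symmetric difference `f (a ⊔ b) - f (a ⊓ b)`. -/
lemma sup_sub_inf_triangle_of_modular {L : Type*} [DistribLattice L] {f : L → ℝ}
    (hmono : ∀ a b : L, a ≤ b → f a ≤ f b)
    (hmod : ∀ a b : L, f (a ⊔ b) + f (a ⊓ b) = f a + f b) (a b c : L) :
    f (a ⊔ b ⊔ c) - f (a ⊓ b) ≤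
      (f (a ⊔ c) - f (a ⊓ c)) + (f (c ⊔ b) - f (c ⊓ b)) := by
  have h₁ := hmod (a ⊔ c) (c ⊔ b)
  have h₂ := hmod (a ⊓ c) (c ⊓ b)
  have h₃ : f (a ⊔ b ⊔ c) ≤ f ((a ⊔ c) ⊔ (c ⊔ b)) :=
    hmono _ _ (sup_le (sup_le (le_sup_left.trans le_sup_left)
      (le_sup_right.trans le_sup_right)) (le_sup_right.trans le_sup_left))
  have h₄ : f ((a ⊓ c) ⊔ (c ⊓ b)) ≤ f ((a ⊔ c) ⊓ (c ⊔ b)) :=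
    hmono _ _ ((sup_le inf_le_right inf_le_left).trans (le_inf le_sup_right le_sup_left))
  have h₅ : f ((a ⊓ c) ⊓ (c ⊓ b)) ≤ f (a ⊓ b) :=
    hmono _ _ (inf_le_inf inf_le_left inf_le_right)
  linarith

theorem lattice_modular_jaccard_triangle {L : Type*} [DistribLattice L]
    (f : L → ℝ)
    (hnonneg : ∀ a : L, 0 ≤ f a)
    (hmono : ∀ a b : L, a ≤ b → f a ≤ f b)
    (hmod : ∀ a b : L, f (a ⊔ b) + f (a ⊓ b) = f a + f b) :
    ∀ a b c : L, latticeJdelta f a b ≤ latticeJdelta f a c + latticeJdelta f c b := by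
  intro a b c
  have hac := latticeJdelta_nonneg hnonneg hmono a c
  have hcb := latticeJdelta_nonneg hnonneg hmono c b
  have hab_le : f (a ⊔ b) ≤ f (a ⊔ b ⊔ c) := hmono _ _ le_sup_left
  have hac_le : f (a ⊔ c) ≤ f (a ⊔ b ⊔ c) := hmono _ _ (sup_le_sup_right le_sup_left c)
  have hcb_le : f (c ⊔ b) ≤ f (a ⊔ b ⊔ c) :=
    hmono _ _ (sup_le le_sup_right (le_sup_right.trans le_sup_left))
  rcases (hnonneg (a ⊔ b ⊔ c)).eq_or_lt with hU | hU
  · have hab : f (a ⊔ b) = 0 := le_antisymm (hab_le.trans hU.ge) (hnonneg _)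
    have hJ : latticeJdelta f a b = 0 := if_pos hab
    linarith
  · refine le_of_mul_le_mul_right ?_ hU
    have h₁ := mul_le_mul_of_nonneg_left hac_le hac
    have h₂ := mul_le_mul_of_nonneg_left hcb_le hcb
    have h₃ := mul_le_mul_of_nonneg_right (latticeJdelta_le_one hnonneg a b)
      (sub_nonneg.2 hab_le)
    rw [latticeJdelta_mul_sup hnonneg hmono] at h₁ h₂
    have h₄ := latticeJdelta_mul_sup hnonneg hmono a b
    have h₅ := sup_sub_inf_triangle_of_modular hmono hmod a b c
    linarith
end

section
/- For finite multisets A and B over a type α, define the multiset Jaccard distance d(A,B) = 1 − |A ∩ B|/|A ∪ B| if A ∪ B is nonempty (where ∩ takes coordinatewise minimum of multiplicities, ∪ takes coordinatewise maximum, and |·| is the total number of elements counted with multiplicity), and d(A,B) = 0 if both are empty. Then for all finite multisets A, B, C, the triangle inequality d(A,B) ≤ d(A,C) + d(C,B) holds. -/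
/-- The Jaccard distance on finite multisets. -/
noncomputable def multisetJaccardDist {α : Type*} [DecidableEq α]
    (A B : Multiset α) : ℝ :=
  if A ∪ B = 0 then 0
  else 1 - ((A ∩ B).card : ℝ) / ((A ∪ B).card : ℝ)

theorem multisetJaccardDist_eq_div {α : Type*} [DecidableEq α] (A B : Multiset α) :
    multisetJaccardDist A B =
      (((A ∪ B).card : ℝ) - ((A ∩ B).card : ℝ)) / ((A ∪ B).card : ℝ) := by
  unfold multisetJaccardDist
  split_ifs with h
  · simp [h]
  · have h0 : ((A ∪ B).card : ℝ) ≠ 0 := by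
      exact_mod_cast mt Multiset.card_eq_zero.mp h
    rw [sub_div, div_self h0]

theorem Multiset.card_inter_add_card_inter_le {α : Type*} [DecidableEq α]
    (A B C : Multiset α) :
    (A ∩ C).card + (C ∩ B).card ≤ C.card + (A ∩ B).card := by
  rw [← Multiset.card_add, ← Multiset.card_add]
  refine Multiset.card_le_card (Multiset.le_iff_count.mpr fun x => ?_)
  simp only [Multiset.count_add, Multiset.count_inter]
  omega

theorem Multiset.card_union_add_card_inter_real {α : Type*} [DecidableEq α]
    (A B : Multiset α) :
    ((A ∪ B).card : ℝ) + ((A ∩ B).card : ℝ) = A.card + B.card := by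
  have h := congrArg Multiset.card (Multiset.union_add_inter A B)
  rw [Multiset.card_add, Multiset.card_add] at h
  exact_mod_cast h

theorem div_le_div_of_nonneg_of_le_of_le {x u s : ℝ} (hx : 0 ≤ x) (hxu : x ≤ u) (hus : u ≤ s) :
    x / s ≤ x / u := by
  rcases hx.eq_or_lt with rfl | hx
  · simp
  · exact div_le_div_of_nonneg_left hx.le (hx.trans_le hxu) hus

theorem multisetJaccardDist_triangle {α : Type*} [DecidableEq α]
    (A B C : Multiset α) :
    multisetJaccardDist A B ≤ multisetJaccardDist A C + multisetJaccardDist C B := by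
  simp only [multisetJaccardDist_eq_div]
  have hAB := Multiset.card_union_add_card_inter_real A B
  have hAC := Multiset.card_union_add_card_inter_real A C
  have hCB := Multiset.card_union_add_card_inter_real C B
  have htri : ((A ∩ C).card : ℝ) + (C ∩ B).card ≤ C.card + (A ∩ B).card := by
    exact_mod_cast Multiset.card_inter_add_card_inter_le A B C
  have hA : ((A ∩ C).card : ℝ) ≤ A.card := by
    exact_mod_cast Multiset.card_le_card Multiset.inter_le_left
  have hC₁ : ((A ∩ C).card : ℝ) ≤ C.card := by
    exact_mod_cast Multiset.card_le_card Multiset.inter_le_right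
  have hC₂ : ((C ∩ B).card : ℝ) ≤ C.card := by
    exact_mod_cast Multiset.card_le_card Multiset.inter_le_left
  have hB : ((C ∩ B).card : ℝ) ≤ B.card := by
    exact_mod_cast Multiset.card_le_card Multiset.inter_le_right
  have hi : (0 : ℝ) ≤ (A ∩ B).card := Nat.cast_nonneg _
  have hi₁ : (0 : ℝ) ≤ (A ∩ C).card := Nat.cast_nonneg _
  have hi₂ : (0 : ℝ) ≤ (C ∩ B).card := Nat.cast_nonneg _
  have hu : (0 : ℝ) ≤ (A ∪ B).card := Nat.cast_nonneg _
  generalize ((A ∪ B).card : ℝ) = u at *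
  generalize ((A ∪ C).card : ℝ) = v at *
  generalize ((C ∪ B).card : ℝ) = w at *
  generalize ((A ∩ B).card : ℝ) = i at *
  generalize ((A ∩ C).card : ℝ) = j at *
  generalize ((C ∩ B).card : ℝ) = k at *
  generalize (A.card : ℝ) = a at *
  generalize (B.card : ℝ) = b at *
  generalize (C.card : ℝ) = c at *
  -- `s` is half of `|A| + |B| + |A ∆ C| + |C ∆ B|`.
  obtain ⟨s, hs⟩ : ∃ s, s = a + b + c - j - k := ⟨_, rfl⟩
  have hv : (v - j) / s ≤ (v - j) / v :=
    div_le_div_of_nonneg_of_le_of_le (by linarith) (by linarith) (by linarith)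
  have hw : (w - k) / s ≤ (w - k) / w :=
    div_le_div_of_nonneg_of_le_of_le (by linarith) (by linarith) (by linarith)
  refine le_trans ?_ (add_le_add hv hw)
  rw [← add_div]
  rcases hu.eq_or_lt with rfl | hu
  · rw [div_zero]
    exact div_nonneg (by linarith) (by linarith)
  · rw [div_le_div_iff₀ hu (by linarith)]
    nlinarith [mul_nonneg hi (show 0 ≤ s - u by linarith),
      mul_nonneg hu.le (show 0 ≤ s - u by linarith)]
end
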